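/- Fix θ ∈ (0,1) and b ∈ (0,∞), set g(τ) := b τ^{-θ}, and let a : [0,∞) → [0,∞) be measurable, non-increasing and bounded. Suppose f : (0,∞) → [0,∞) is measurable, solves f(t) = a(t) + ∫₀ᵗ f(s) g(t-s) ds for all t > 0, and satisfies limsup_{t→∞} (1/t) log f(t) < ∞. If H : (0,∞) → [0,∞) is measurable, satisfies the subsolution inequality H(t) ≤ a(t) + ∫₀ᵗ H(s) g(t-s) ds for all t > 0, and sup_{t>0} e^{-γt} H(t) < ∞ for some γ > 0, then H(t) ≤ f(t) for all t > 0. -/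

import Mathlib

open MeasureTheory Filter

open scoped ENNReal

/-- The kernel `b τ ^ (-θ)` has exponentially weighted mass at most `1 / 2` for a large weight. -/
lemma exists_lintegral_exp_mul_rpow_le_half (θ b : ℝ) (hθ : θ < 1) (hb : 0 < b) :
    ∃ r > (0 : ℝ), ∫⁻ τ in Set.Ioi (0 : ℝ),
      ENNReal.ofReal (Real.exp (-(r * τ))) * ENNReal.ofReal (b * τ ^ (-θ)) ≤ 2⁻¹ := by
  have h1 : 0 < 1 - θ := by linarith
  have hG : 0 < Real.Gamma (1 - θ) := Real.Gamma_pos_of_pos h1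
  set q : ℝ := (1 / (2 * b * Real.Gamma (1 - θ))) ^ (1 / (1 - θ)) with hq
  have hq0 : 0 < q := by positivity
  have hr : 0 < q⁻¹ := by positivity
  refine ⟨q⁻¹, hr, ?_⟩
  have hval := Real.integral_rpow_mul_exp_neg_mul_Ioi h1 hr
  have hpow : (1 / q⁻¹) ^ (1 - θ) = 1 / (2 * b * Real.Gamma (1 - θ)) := by
    rw [one_div, inv_inv, hq, ← Real.rpow_mul (by positivity), one_div_mul_cancel h1.ne',
      Real.rpow_one]
  rw [hpow] at hval
  have hint : IntegrableOn (fun t : ℝ => t ^ (1 - θ - 1) * Real.exp (-(q⁻¹ * t)))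
      (Set.Ioi 0) := by
    by_contra hn
    rw [integral_undef hn] at hval
    have : 0 < 1 / (2 * b * Real.Gamma (1 - θ)) * Real.Gamma (1 - θ) := by positivity
    linarith
  have hcongr : ∫⁻ τ in Set.Ioi (0 : ℝ),
      ENNReal.ofReal (Real.exp (-(q⁻¹ * τ))) * ENNReal.ofReal (b * τ ^ (-θ)) =
      ∫⁻ τ in Set.Ioi (0 : ℝ),
        ENNReal.ofReal (b * (τ ^ (1 - θ - 1) * Real.exp (-(q⁻¹ * τ)))) := by
    refine setLIntegral_congr_fun measurableSet_Ioi fun τ _ => ?_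
    rw [← ENNReal.ofReal_mul (Real.exp_pos _).le, show 1 - θ - 1 = -θ by ring]
    congr 1
    ring
  rw [hcongr, ← ofReal_integral_eq_lintegral_ofReal (hint.const_mul b)
    ((ae_restrict_iff' measurableSet_Ioi).2 (ae_of_all _ fun τ (hτ : 0 < τ) => by positivity)),
    integral_const_mul, hval]
  have : b * (1 / (2 * b * Real.Gamma (1 - θ)) * Real.Gamma (1 - θ)) = 2⁻¹ := by
    field_simp
  rw [this, ENNReal.ofReal_inv_of_pos two_pos]
  simp

/-- Young's inequality for causal convolutions in exponentially weighted `L¹(0, T)`. -/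
lemma lintegral_exp_mul_convolution_le (k D : ℝ → ℝ≥0∞) (hk : Measurable k) (hD : Measurable D)
    (r T : ℝ) :
    ∫⁻ t in Set.Ioo 0 T,
        ENNReal.ofReal (Real.exp (-(r * t))) * ∫⁻ s in Set.Ioo 0 t, D s * k (t - s) ≤
      (∫⁻ s in Set.Ioo 0 T, ENNReal.ofReal (Real.exp (-(r * s))) * D s) *
        ∫⁻ τ in Set.Ioi (0 : ℝ), ENNReal.ofReal (Real.exp (-(r * τ))) * k τ := by
  set w : ℝ → ℝ≥0∞ := fun x => ENNReal.ofReal (Real.exp (-(r * x))) with hw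
  have hwm : Measurable w := by fun_prop
  have hw_add : ∀ s t, w t = w s * w (t - s) := fun s t => by
    simp only [hw]
    rw [← ENNReal.ofReal_mul (Real.exp_pos _).le, ← Real.exp_add]
    congr 2
    ring
  set K : ℝ → ℝ≥0∞ := (Set.Ioi (0 : ℝ)).indicator fun τ => w τ * k τ with hK
  have hKm : Measurable K := (hwm.mul hk).indicator measurableSet_Ioi
  calc ∫⁻ t in Set.Ioo 0 T, w t * ∫⁻ s in Set.Ioo 0 t, D s * k (t - s)
      ≤ ∫⁻ t in Set.Ioo 0 T, ∫⁻ s in Set.Ioo 0 T, w s * D s * K (t - s) := by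
        refine setLIntegral_mono' measurableSet_Ioo fun t ht => ?_
        rw [← lintegral_const_mul _ (by fun_prop)]
        refine le_trans (le_of_eq ?_)
          (lintegral_mono_set (Set.Ioo_subset_Ioo_right ht.2.le))
        refine setLIntegral_congr_fun measurableSet_Ioo fun s hs => ?_
        rw [hK, Set.indicator_of_mem (by simpa using hs.2), hw_add s t]
        ring
    _ ≤ ∫⁻ t, ∫⁻ s in Set.Ioo 0 T, w s * D s * K (t - s) := setLIntegral_le_lintegral _ _
    _ = ∫⁻ s in Set.Ioo 0 T, ∫⁻ t, w s * D s * K (t - s) :=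
        lintegral_lintegral_swap (by fun_prop)
    _ = ∫⁻ s in Set.Ioo 0 T, w s * D s * ∫⁻ τ, K τ := by
        refine lintegral_congr fun s => ?_
        rw [lintegral_const_mul _ (by fun_prop), lintegral_sub_right_eq_self K s]
    _ = _ := by
        rw [lintegral_mul_const _ (by fun_prop), hK, lintegral_indicator measurableSet_Ioi]

/-- An integrable subsolution of the homogeneous renewal equation vanishes. -/
lemma ae_eq_zero_of_le_convolution (k D : ℝ → ℝ≥0∞) (hk : Measurable k) (hD : Measurable D)
    (r T : ℝ)
    (hr : ∫⁻ τ in Set.Ioi (0 : ℝ), ENNReal.ofReal (Real.exp (-(r * τ))) * k τ ≤ 2⁻¹)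
    (hsub : ∀ t > 0, D t ≤ ∫⁻ s in Set.Ioo 0 t, D s * k (t - s))
    (hfin : ∫⁻ s in Set.Ioo 0 T, D s ≠ ∞) :
    ∀ᵐ s ∂volume.restrict (Set.Ioo 0 T), D s = 0 := by
  set I := ∫⁻ s in Set.Ioo 0 T, ENNReal.ofReal (Real.exp (-(r * s))) * D s with hI
  have hIfin : I ≠ ∞ := by
    refine ne_top_of_le_ne_top
      (ENNReal.mul_ne_top (ENNReal.ofReal_ne_top (r := Real.exp (|r| * T))) hfin) ?_
    rw [hI, ← lintegral_const_mul _ hD]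
    refine setLIntegral_mono' measurableSet_Ioo fun s hs => ?_
    gcongr
    nlinarith [neg_abs_le r, abs_nonneg r, hs.1, hs.2]
  have hle : I ≤ I * 2⁻¹ := by
    refine le_trans ?_ ((lintegral_exp_mul_convolution_le k D hk hD r T).trans
      (mul_le_mul_right hr I))
    refine setLIntegral_mono' measurableSet_Ioo fun s hs => ?_
    gcongr
    exact hsub s hs.1
  have hI0 : I = 0 := by
    by_contra h0
    rw [← div_eq_mul_inv] at hle
    exact (ENNReal.half_lt_self h0 hIfin).not_ge hle
  rw [hI, lintegral_eq_zero_iff (by fun_prop)] at hI0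
  filter_upwards [hI0] with s hs
  have : ENNReal.ofReal (Real.exp (-(r * s))) ≠ 0 := by
    simpa using Real.exp_pos _
  simpa [this] using hs

/-- A multiple of the exponential is a supersolution of the renewal equation. -/
lemma add_convolution_exp_le (k : ℝ → ℝ≥0∞) (hk : Measurable k) (r t C : ℝ)
    (hr0 : 0 ≤ r) (ht : 0 < t) (hC : 0 ≤ C)
    (hr : ∫⁻ τ in Set.Ioi (0 : ℝ), ENNReal.ofReal (Real.exp (-(r * τ))) * k τ ≤ 2⁻¹) :
    ENNReal.ofReal C +
        ∫⁻ s in Set.Ioo 0 t, ENNReal.ofReal (2 * C * Real.exp (r * s)) * k (t - s) ≤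
      ENNReal.ofReal (2 * C * Real.exp (r * t)) := by
  set K : ℝ → ℝ≥0∞ := (Set.Ioi (0 : ℝ)).indicator
    fun τ => ENNReal.ofReal (Real.exp (-(r * τ))) * k τ with hK
  have hKm : Measurable K := by
    refine Measurable.indicator ?_ measurableSet_Ioi
    fun_prop
  have h1 : ∫⁻ s in Set.Ioo 0 t, ENNReal.ofReal (2 * C * Real.exp (r * s)) * k (t - s) ≤
      ENNReal.ofReal (2 * C * Real.exp (r * t)) * 2⁻¹ := by
    calc _ = ∫⁻ s in Set.Ioo 0 t, ENNReal.ofReal (2 * C * Real.exp (r * t)) * K (t - s) := by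
          refine setLIntegral_congr_fun measurableSet_Ioo fun s hs => ?_
          rw [hK, Set.indicator_of_mem (by simpa using hs.2), ← mul_assoc,
            ← ENNReal.ofReal_mul (by positivity), mul_assoc (2 * C), ← Real.exp_add]
          congr 4
          ring
      _ ≤ ∫⁻ s, ENNReal.ofReal (2 * C * Real.exp (r * t)) * K (t - s) :=
          setLIntegral_le_lintegral _ _
      _ = ENNReal.ofReal (2 * C * Real.exp (r * t)) * ∫⁻ τ, K τ := by
          rw [lintegral_const_mul _ (by fun_prop), lintegral_sub_left_eq_self K t]
      _ ≤ _ := by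
          rw [hK, lintegral_indicator measurableSet_Ioi]
          gcongr
  have h2 : ENNReal.ofReal C ≤ ENNReal.ofReal (2 * C * Real.exp (r * t)) * 2⁻¹ := by
    have h3 : (2⁻¹ : ℝ≥0∞) = ENNReal.ofReal 2⁻¹ := by
      rw [ENNReal.ofReal_inv_of_pos two_pos]; simp
    rw [h3, ← ENNReal.ofReal_mul (by positivity)]
    apply ENNReal.ofReal_le_ofReal
    have : 1 ≤ Real.exp (r * t) := Real.one_le_exp (by positivity)
    nlinarith
  calc _ ≤ ENNReal.ofReal (2 * C * Real.exp (r * t)) * 2⁻¹ +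
        ENNReal.ofReal (2 * C * Real.exp (r * t)) * 2⁻¹ := add_le_add h2 h1
    _ = _ := by rw [← mul_add, ENNReal.inv_two_add_inv_two, mul_one]

/-- If `u` is a subsolution and `v` a supersolution, then the positive part of `u - v` is a
subsolution of the homogeneous equation. -/
lemma tsub_le_convolution (k u v : ℝ → ℝ≥0∞) (hk : Measurable k) (hv : Measurable v)
    (α : ℝ≥0∞) (t : ℝ)
    (hu_sub : u t ≤ α + ∫⁻ s in Set.Ioo 0 t, u s * k (t - s))
    (hv_sup : α + ∫⁻ s in Set.Ioo 0 t, v s * k (t - s) ≤ v t) :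
    u t - v t ≤ ∫⁻ s in Set.Ioo 0 t, (u s - v s) * k (t - s) := by
  rw [tsub_le_iff_right]
  calc u t ≤ α + ∫⁻ s in Set.Ioo 0 t, u s * k (t - s) := hu_sub
    _ ≤ α + ∫⁻ s in Set.Ioo 0 t, ((u s - v s) * k (t - s) + v s * k (t - s)) := by
        gcongr with s
        rw [← add_mul]
        gcongr
        exact le_tsub_add
    _ = (∫⁻ s in Set.Ioo 0 t, (u s - v s) * k (t - s)) +
          (α + ∫⁻ s in Set.Ioo 0 t, v s * k (t - s)) := by
        rw [lintegral_add_right _ (by fun_prop)]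
        ring
    _ ≤ _ := by gcongr

/-- A property that holds at every point outside `J`, and almost everywhere below every point of
`J`, holds almost everywhere. -/
lemma ae_of_forall_mem_ae_Ioo (J : Set ℝ) (p : ℝ → Prop)
    (hout : ∀ t > 0, t ∉ J → p t)
    (hin : ∀ t ∈ J, ∀ᵐ s ∂volume.restrict (Set.Ioo 0 t), p s) :
    ∀ᵐ s, 0 < s → p s := by
  have hmax : ∀ᵐ s : ℝ, s ∉ {t | t ∈ J ∧ ∀ u ∈ J, u ≤ t} := by
    refine measure_eq_zero_iff_ae_notMem.1 (Set.Subsingleton.measure_zero ?_ _)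
    exact fun x hx y hy => le_antisymm (hy.2 x hx.1) (hx.2 y hy.1)
  have hrat : ∀ᵐ s : ℝ, ∀ q : ℚ, (∃ u ∈ J, (q : ℝ) ≤ u) → s ∈ Set.Ioo (0 : ℝ) q → p s := by
    rw [ae_all_iff]
    intro q
    by_cases hq : ∃ u ∈ J, (q : ℝ) ≤ u
    · obtain ⟨u, hu, hqu⟩ := hq
      filter_upwards [(ae_restrict_iff' measurableSet_Ioo).1 (hin u hu)] with s hs _ hsq
      exact hs ⟨hsq.1, hsq.2.trans_le hqu⟩
    · exact ae_of_all _ fun s h => absurd h hq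
  filter_upwards [hmax, hrat] with s hs hsq hpos
  by_cases hJ : s ∈ J
  · have : ∃ u ∈ J, s < u := by
      by_contra! hcon
      exact hs ⟨hJ, hcon⟩
    obtain ⟨u, hu, hsu⟩ := this
    obtain ⟨q, hq1, hq2⟩ := exists_rat_btwn hsu
    exact hsq q ⟨u, hu, hq2.le⟩ ⟨hpos, hq1⟩
  · exact hout s hpos hJ

/-- The integrand of the renewal equation, in extended nonnegative reals. -/
lemma setLIntegral_ofReal_mul_rpow (θ b t : ℝ) (F : ℝ → ℝ) (hF : ∀ s > 0, 0 ≤ F s) :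
    ∫⁻ s in Set.Ioo 0 t, ENNReal.ofReal (F s * (b * (t - s) ^ (-θ))) =
      ∫⁻ s in Set.Ioo 0 t, ENNReal.ofReal (F s) * ENNReal.ofReal (b * (t - s) ^ (-θ)) :=
  setLIntegral_congr_fun measurableSet_Ioo fun s hs => ENNReal.ofReal_mul (hF s hs.1)

lemma ae_restrict_mul_rpow_nonneg (θ b t : ℝ) (hb : 0 < b) (F : ℝ → ℝ)
    (hF : ∀ s > 0, 0 ≤ F s) :
    0 ≤ᵐ[volume.restrict (Set.Ioo 0 t)] fun s => F s * (b * (t - s) ^ (-θ)) := by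
  refine (ae_restrict_iff' measurableSet_Ioo).2 (ae_of_all _ fun s hs => ?_)
  have h1 := hF s hs.1
  have h2 : 0 < t - s := sub_pos.2 hs.2
  positivity

lemma ofReal_setIntegral_mul_rpow_le (θ b t : ℝ) (hb : 0 < b) (F : ℝ → ℝ)
    (hF : ∀ s > 0, 0 ≤ F s) :
    ENNReal.ofReal (∫ s in Set.Ioo 0 t, F s * (b * (t - s) ^ (-θ))) ≤
      ∫⁻ s in Set.Ioo 0 t, ENNReal.ofReal (F s) * ENNReal.ofReal (b * (t - s) ^ (-θ)) := by
  by_cases hint : IntegrableOn (fun s => F s * (b * (t - s) ^ (-θ))) (Set.Ioo 0 t)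
  · rw [ofReal_integral_eq_lintegral_ofReal hint (ae_restrict_mul_rpow_nonneg θ b t hb F hF),
      setLIntegral_ofReal_mul_rpow θ b t F hF]
  · rw [integral_undef hint]
    simp

lemma ofReal_le_of_renewal_subsolution (θ b t α : ℝ) (hb : 0 < b) (F : ℝ → ℝ)
    (hF : ∀ s > 0, 0 ≤ F s)
    (hsub : F t ≤ α + ∫ s in Set.Ioo 0 t, F s * (b * (t - s) ^ (-θ))) :
    ENNReal.ofReal (F t) ≤ ENNReal.ofReal α +
      ∫⁻ s in Set.Ioo 0 t, ENNReal.ofReal (F s) * ENNReal.ofReal (b * (t - s) ^ (-θ)) :=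
  (ENNReal.ofReal_le_ofReal hsub).trans (ENNReal.ofReal_add_le.trans
    (add_le_add_right (ofReal_setIntegral_mul_rpow_le θ b t hb F hF) _))

/-- If the convolution integral of `F` exists at `t`, then `F` is integrable on `(0, t)`. -/
lemma setLIntegral_ofReal_ne_top_of_integrableOn (θ b t : ℝ) (hθ : 0 < θ) (hb : 0 < b)
    (ht : 0 < t) (F : ℝ → ℝ) (hFm : Measurable F) (hF : ∀ s > 0, 0 ≤ F s)
    (hint : IntegrableOn (fun s => F s * (b * (t - s) ^ (-θ))) (Set.Ioo 0 t)) :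
    ∫⁻ s in Set.Ioo 0 t, ENNReal.ofReal (F s) ≠ ∞ := by
  have h1 := hint.lintegral_lt_top
  rw [setLIntegral_ofReal_mul_rpow θ b t F hF] at h1
  have h2 : (∫⁻ s in Set.Ioo 0 t, ENNReal.ofReal (F s)) * ENNReal.ofReal (b * t ^ (-θ)) < ∞ := by
    refine lt_of_le_of_lt ?_ h1
    rw [← lintegral_mul_const _ (by fun_prop)]
    refine setLIntegral_mono' measurableSet_Ioo fun s hs => ?_
    gcongr ENNReal.ofReal (F s) * ENNReal.ofReal (b * ?_)
    exact Real.rpow_le_rpow_of_nonpos (sub_pos.2 hs.2) (by linarith [hs.1]) (by linarith)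
  intro htop
  have h3 : ENNReal.ofReal (b * t ^ (-θ)) ≠ 0 := by
    have : 0 < b * t ^ (-θ) := by positivity
    simpa using this
  rw [htop, ENNReal.top_mul h3] at h2
  exact lt_irrefl _ h2

/-- A nonnegative solution of the renewal equation with bounded forcing is almost everywhere
bounded by an exponential. No integrability is assumed: where the convolution integral diverges,
the equation is read with the integral equal to zero. -/
lemma ae_le_exp_of_renewal (θ b r C : ℝ) (hθ : 0 < θ) (hb : 0 < b) (hr0 : 0 ≤ r) (hC : 0 ≤ C)
    (hr : ∫⁻ τ in Set.Ioi (0 : ℝ),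
      ENNReal.ofReal (Real.exp (-(r * τ))) * ENNReal.ofReal (b * τ ^ (-θ)) ≤ 2⁻¹)
    (a f : ℝ → ℝ) (ha : ∀ t > 0, a t ≤ C) (hfm : Measurable f) (hf : ∀ t > 0, 0 ≤ f t)
    (hf_eq : ∀ t > (0 : ℝ), f t = a t + ∫ s in Set.Ioo 0 t, f s * (b * (t - s) ^ (-θ))) :
    ∀ᵐ s, 0 < s → ENNReal.ofReal (f s) ≤ ENNReal.ofReal (2 * C * Real.exp (r * s)) := by
  have hk : Measurable fun τ : ℝ => ENNReal.ofReal (b * τ ^ (-θ)) := by fun_prop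
  refine ae_of_forall_mem_ae_Ioo
    {t | 0 < t ∧ IntegrableOn (fun s => f s * (b * (t - s) ^ (-θ))) (Set.Ioo 0 t)} _ ?_ ?_
  · intro t ht hJ
    have hundef : ¬ IntegrableOn (fun s => f s * (b * (t - s) ^ (-θ))) (Set.Ioo 0 t) :=
      fun h => hJ ⟨ht, h⟩
    apply ENNReal.ofReal_le_ofReal
    rw [hf_eq t ht, integral_undef hundef]
    have : 1 ≤ Real.exp (r * t) := Real.one_le_exp (by positivity)
    nlinarith [ha t ht]
  · rintro T ⟨hT, hint⟩
    have hzero := ae_eq_zero_of_le_convolution (fun τ => ENNReal.ofReal (b * τ ^ (-θ)))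
      (fun s => ENNReal.ofReal (f s) - ENNReal.ofReal (2 * C * Real.exp (r * s))) hk
      (by fun_prop) r T hr ?_ ?_
    · filter_upwards [hzero] with s hs using tsub_eq_zero_iff_le.1 hs
    · intro t ht
      refine tsub_le_convolution _ (fun s => ENNReal.ofReal (f s))
        (fun s => ENNReal.ofReal (2 * C * Real.exp (r * s))) hk (by fun_prop)
        (ENNReal.ofReal C) t ?_ (add_convolution_exp_le _ hk r t C hr0 ht hC hr)
      refine (ofReal_le_of_renewal_subsolution θ b t (a t) hb f hf (hf_eq t ht).le).trans ?_
      gcongr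
      exact ha t ht
    · exact ne_top_of_le_ne_top
        (setLIntegral_ofReal_ne_top_of_integrableOn θ b T hθ hb hT f hfm hf hint)
        (lintegral_mono fun s => tsub_le_self)

/-- Comparison theorem for the renewal equation: a nonnegative subsolution
of at most exponential growth is dominated by the solution. -/
theorem renewal_subsolution_comparison
    (θ b : ℝ) (hθ : θ ∈ Set.Ioo (0 : ℝ) 1) (hb : 0 < b)
    (a : ℝ → ℝ) (ha_meas : Measurable a)
    (ha_nonneg : ∀ t ≥ (0 : ℝ), 0 ≤ a t)
    (ha_anti : ∀ s t : ℝ, 0 ≤ s → s ≤ t → a t ≤ a s)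
    (ha_bdd : ∃ C : ℝ, ∀ t ≥ (0 : ℝ), a t ≤ C)
    (f : ℝ → ℝ) (hf_meas : Measurable f)
    (hf_nonneg : ∀ t > (0 : ℝ), 0 ≤ f t)
    (hf_eq : ∀ t > (0 : ℝ),
      f t = a t + ∫ s in Set.Ioo (0 : ℝ) t, f s * (b * (t - s) ^ (-θ)))
    (hf_growth :
      limsup (fun t : ℝ => ((Real.log (f t) / t : ℝ) : EReal)) atTop < ⊤)
    (H : ℝ → ℝ) (hH_meas : Measurable H)
    (hH_nonneg : ∀ t > (0 : ℝ), 0 ≤ H t)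
    (hH_sub : ∀ t > (0 : ℝ),
      H t ≤ a t + ∫ s in Set.Ioo (0 : ℝ) t, H s * (b * (t - s) ^ (-θ)))
    (hH_growth : ∃ γ > (0 : ℝ), ∃ K : ℝ,
      ∀ t > (0 : ℝ), Real.exp (-(γ * t)) * H t ≤ K) :
    ∀ t > (0 : ℝ), H t ≤ f t := by
  intro T hT
  obtain ⟨C, hC⟩ := ha_bdd
  have hC0 : 0 ≤ C := (ha_nonneg 0 le_rfl).trans (hC 0 le_rfl)
  obtain ⟨r, hr0, hr⟩ := exists_lintegral_exp_mul_rpow_le_half θ b hθ.2 hb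
  have hk : Measurable fun τ : ℝ => ENNReal.ofReal (b * τ ^ (-θ)) := by fun_prop
  have hbound := ae_le_exp_of_renewal θ b r C hθ.1 hb hr0.le hC0 hr a f
    (fun t ht => hC t ht.le) hf_meas hf_nonneg hf_eq
  have hint : ∀ t > 0, IntegrableOn (fun s => f s * (b * (t - s) ^ (-θ))) (Set.Ioo 0 t) := by
    intro t ht
    refine ⟨by fun_prop, ?_⟩
    rw [hasFiniteIntegral_iff_ofReal (ae_restrict_mul_rpow_nonneg θ b t hb f hf_nonneg),
      setLIntegral_ofReal_mul_rpow θ b t f hf_nonneg]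
    refine lt_of_le_of_lt (lintegral_mono_ae ?_) (lt_of_le_of_lt (le_add_self.trans
      (add_convolution_exp_le _ hk r t C hr0.le ht hC0 hr)) ENNReal.ofReal_lt_top)
    refine (ae_restrict_iff' measurableSet_Ioo).2 ?_
    filter_upwards [hbound] with s hs hst
    exact mul_le_mul_left (hs hst.1) _
  have hf_sup : ∀ t > 0, ENNReal.ofReal (a t) + ∫⁻ s in Set.Ioo 0 t,
      ENNReal.ofReal (f s) * ENNReal.ofReal (b * (t - s) ^ (-θ)) ≤ ENNReal.ofReal (f t) := by
    intro t ht
    have hnn := ae_restrict_mul_rpow_nonneg θ b t hb f hf_nonneg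
    rw [hf_eq t ht, ENNReal.ofReal_add (ha_nonneg t ht.le) (integral_nonneg_of_ae hnn),
      ofReal_integral_eq_lintegral_ofReal (hint t ht) hnn,
      setLIntegral_ofReal_mul_rpow θ b t f hf_nonneg]
  have hsub : ∀ t > 0, ENNReal.ofReal (H t) - ENNReal.ofReal (f t) ≤ ∫⁻ s in Set.Ioo 0 t,
      (ENNReal.ofReal (H s) - ENNReal.ofReal (f s)) * ENNReal.ofReal (b * (t - s) ^ (-θ)) :=
    fun t ht => tsub_le_convolution (fun τ => ENNReal.ofReal (b * τ ^ (-θ)))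
      (fun s => ENNReal.ofReal (H s)) (fun s => ENNReal.ofReal (f s)) hk (by fun_prop) _ t
      (ofReal_le_of_renewal_subsolution θ b t (a t) hb H hH_nonneg (hH_sub t ht)) (hf_sup t ht)
  have hfin : ∫⁻ s in Set.Ioo 0 T, (ENNReal.ofReal (H s) - ENNReal.ofReal (f s)) ≠ ∞ := by
    obtain ⟨γ, hγ, K, hK⟩ := hH_growth
    refine ne_top_of_le_ne_top (b := ∫⁻ _ in Set.Ioo 0 T,
      ENNReal.ofReal (|K| * Real.exp (γ * T))) ?_ ?_
    · rw [setLIntegral_const, Real.volume_Ioo]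
      exact ENNReal.mul_ne_top ENNReal.ofReal_ne_top ENNReal.ofReal_ne_top
    · refine setLIntegral_mono' measurableSet_Ioo fun s hs => ?_
      refine tsub_le_self.trans (ENNReal.ofReal_le_ofReal ?_)
      calc H s = Real.exp (-(γ * s)) * H s * Real.exp (γ * s) := by
            rw [mul_right_comm, ← Real.exp_add]
            simp
        _ ≤ |K| * Real.exp (γ * T) := by
            gcongr
            · exact (hK s hs.1).trans (le_abs_self K)
            · exact hs.2.le
  have hzero := ae_eq_zero_of_le_convolution (fun τ => ENNReal.ofReal (b * τ ^ (-θ)))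
    (fun s => ENNReal.ofReal (H s) - ENNReal.ofReal (f s)) hk (by fun_prop) r T hr hsub hfin
  have hT0 : ENNReal.ofReal (H T) - ENNReal.ofReal (f T) ≤ 0 := by
    refine (hsub T hT).trans_eq ?_
    rw [lintegral_congr_ae (g := fun _ => 0)]
    · simp
    · filter_upwards [hzero] with s hs
      rw [hs, zero_mul]
  exact (ENNReal.ofReal_le_ofReal_iff (hf_nonneg T hT)).1
    (tsub_eq_zero_iff_le.1 (nonpos_iff_eq_zero.1 hT0))
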